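/- Let n ≥ 1, γ > 0, and let g : ℝⁿ → ℝ (ℝⁿ with the Euclidean norm) be convex and M-Lipschitz; let f(x) = ∫ g(x + γe) dP(e) with P the uniform probability measure on the closed Euclidean unit ball of ℝⁿ. Then f is differentiable on ℝⁿ and its gradient is (M√n/γ)-Lipschitz: ‖∇f(x) − ∇f(y)‖ ≤ (M√n/γ)·‖x − y‖ for all x, y ∈ ℝⁿ. -/

import Mathlib

open MeasureTheory

/-- A form of Gautschi's inequality for the Gamma function. -/
lemma Real.Gamma_add_half_le {s : ℝ} (hs : 0 < s) :
    Real.Gamma (s + 1 / 2) ≤ √s * Real.Gamma s := by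
  have h := Real.Gamma_mul_add_mul_le_rpow_Gamma_mul_rpow_Gamma (s := s) (t := s + 1)
    (a := 1 / 2) (b := 1 / 2) hs (by linarith) (by norm_num) (by norm_num) (by norm_num)
  have hG := (Real.Gamma_pos_of_pos hs).le
  rw [← Real.sqrt_eq_rpow, ← Real.sqrt_eq_rpow, Real.Gamma_add_one hs.ne',
    Real.sqrt_mul hs.le, mul_left_comm, Real.mul_self_sqrt hG] at h
  convert h using 2
  ring

lemma Real.two_mul_Gamma_half_add_one_le (m : ℕ) :
    2 * Real.Gamma (((m + 1 : ℕ) : ℝ) / 2 + 1) ≤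
      √((m + 1 : ℕ) : ℝ) * √Real.pi * Real.Gamma ((m : ℝ) / 2 + 1) := by
  rcases Nat.eq_zero_or_pos m with rfl | hm
  · have h := Real.Gamma_add_one (s := 1 / 2) (by norm_num)
    rw [Real.Gamma_one_half_eq] at h
    norm_num at h ⊢
    linarith
  · have hm' : (1 : ℝ) ≤ m := by exact_mod_cast hm
    have h := Real.Gamma_add_half_le (s := (m : ℝ) / 2 + 1) (by positivity)
    have hsqrt : 2 * √((m : ℝ) / 2 + 1) ≤ √((m + 1 : ℕ) : ℝ) * √Real.pi := by
      rw [← Real.sqrt_mul (by positivity)]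
      apply Real.le_sqrt_of_sq_le
      rw [mul_pow, Real.sq_sqrt (by positivity)]
      push_cast
      nlinarith [Real.pi_gt_three]
    have hG : 0 ≤ Real.Gamma ((m : ℝ) / 2 + 1) := Real.Gamma_nonneg_of_nonneg (by positivity)
    calc 2 * Real.Gamma (((m + 1 : ℕ) : ℝ) / 2 + 1)
        = 2 * Real.Gamma ((m : ℝ) / 2 + 1 + 1 / 2) := by
          congr 2; push_cast; ring
      _ ≤ 2 * √((m : ℝ) / 2 + 1) * Real.Gamma ((m : ℝ) / 2 + 1) := by
          rw [mul_assoc]; gcongr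
      _ ≤ _ := by gcongr

namespace EuclideanSpace

lemma volume_real_closedBall_zero_one (m : ℕ) :
    volume.real (Metric.closedBall (0 : EuclideanSpace ℝ (Fin m)) 1) =
      √Real.pi ^ m / Real.Gamma ((m : ℝ) / 2 + 1) := by
  rcases Nat.eq_zero_or_pos m with rfl | hm
  · have h : Metric.closedBall (0 : EuclideanSpace ℝ (Fin 0)) 1 = Set.univ :=
      Set.eq_univ_of_forall fun x => by simp [Subsingleton.elim x 0]
    rw [h, Measure.real, volume_euclideanSpace_eq_dirac]
    simp
  · have : Nonempty (Fin m) := ⟨⟨0, hm⟩⟩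
    have hG : 0 < Real.Gamma ((m : ℝ) / 2 + 1) := Real.Gamma_pos_of_pos (by positivity)
    rw [Measure.real, EuclideanSpace.volume_closedBall]
    simp only [ENNReal.ofReal_one, one_pow, one_mul, Fintype.card_fin]
    exact ENNReal.toReal_ofReal (by positivity)

/-- Comparison of the volumes of unit balls in consecutive dimensions. -/
lemma two_mul_volume_real_closedBall_le (m : ℕ) :
    2 * volume.real (Metric.closedBall (0 : EuclideanSpace ℝ (Fin m)) 1) ≤
      √((m + 1 : ℕ) : ℝ) *
        volume.real (Metric.closedBall (0 : EuclideanSpace ℝ (Fin (m + 1))) 1) := by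
  rw [volume_real_closedBall_zero_one, volume_real_closedBall_zero_one]
  have h := Real.two_mul_Gamma_half_add_one_le m
  have h₁ : 0 < Real.Gamma ((m : ℝ) / 2 + 1) := Real.Gamma_pos_of_pos (by positivity)
  have h₂ : 0 < Real.Gamma (((m + 1 : ℕ) : ℝ) / 2 + 1) := Real.Gamma_pos_of_pos (by positivity)
  rw [← mul_div_assoc, ← mul_div_assoc, div_le_div_iff₀ h₁ h₂]
  calc 2 * √Real.pi ^ m * Real.Gamma (((m + 1 : ℕ) : ℝ) / 2 + 1)
      = √Real.pi ^ m * (2 * Real.Gamma (((m + 1 : ℕ) : ℝ) / 2 + 1)) := by ring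
    _ ≤ √Real.pi ^ m * (√((m + 1 : ℕ) : ℝ) * √Real.pi * Real.Gamma ((m : ℝ) / 2 + 1)) := by
        gcongr
    _ = _ := by ring

/-- Splitting off the first coordinate of a Euclidean vector. -/
def headTail (m : ℕ) (x : EuclideanSpace ℝ (Fin (m + 1))) : ℝ × EuclideanSpace ℝ (Fin m) :=
  (x 0, WithLp.toLp 2 fun i => x i.succ)

lemma measurePreserving_headTail (m : ℕ) : MeasurePreserving (headTail m) :=
  ((MeasurePreserving.id volume).prod (PiLp.volume_preserving_toLp (Fin m))).comp
    ((volume_preserving_piFinSuccAbove (fun _ : Fin (m + 1) => ℝ) 0).comp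
      (PiLp.volume_preserving_ofLp (Fin (m + 1))))

lemma norm_sq_eq_headTail {m : ℕ} (x : EuclideanSpace ℝ (Fin (m + 1))) :
    ‖x‖ ^ 2 = (headTail m x).1 ^ 2 + ‖(headTail m x).2‖ ^ 2 := by
  simp [EuclideanSpace.norm_sq_eq, headTail, Fin.sum_univ_succ]

lemma volume_closedBall_diff_single_le {m : ℕ} {c : ℝ} (hc : 0 ≤ c) :
    volume (Metric.closedBall (0 : EuclideanSpace ℝ (Fin (m + 1))) 1 \
      (fun z => z + EuclideanSpace.single 0 c) ⁻¹' Metric.closedBall 0 1) ≤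
      ENNReal.ofReal c * volume (Metric.closedBall (0 : EuclideanSpace ℝ (Fin m)) 1) := by
  set A : Set (ℝ × EuclideanSpace ℝ (Fin m)) :=
    {p | p.1 ^ 2 + ‖p.2‖ ^ 2 ≤ 1 ∧ 1 < (p.1 + c) ^ 2 + ‖p.2‖ ^ 2} with hA
  have hAm : MeasurableSet A :=
    (measurableSet_le (f := fun p : ℝ × EuclideanSpace ℝ (Fin m) => p.1 ^ 2 + ‖p.2‖ ^ 2)
      (by fun_prop) measurable_const).inter
    (measurableSet_lt (g := fun p : ℝ × EuclideanSpace ℝ (Fin m) => (p.1 + c) ^ 2 + ‖p.2‖ ^ 2)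
      measurable_const (by fun_prop))
  have hpre : Metric.closedBall (0 : EuclideanSpace ℝ (Fin (m + 1))) 1 \
      (fun z => z + EuclideanSpace.single 0 c) ⁻¹' Metric.closedBall 0 1 =
      headTail m ⁻¹' A := by
    ext z
    have h (w : EuclideanSpace ℝ (Fin (m + 1))) : ‖w‖ ≤ 1 ↔ ‖w‖ ^ 2 ≤ 1 := by
      rw [sq_le_one_iff₀ (norm_nonneg w)]
    have hz : headTail m (z + EuclideanSpace.single 0 c) =
        ((headTail m z).1 + c, (headTail m z).2) := by
      simp [headTail]
    simp only [Set.mem_sdiff, Set.mem_preimage, mem_closedBall_zero_iff, h, norm_sq_eq_headTail,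
      hz, not_le, hA, Set.mem_ofPred_eq]
  rw [hpre, (measurePreserving_headTail m).measure_preimage hAm.nullMeasurableSet,
    Measure.volume_eq_prod, Measure.prod_apply_symm hAm]
  calc ∫⁻ y, volume ((fun x => (x, y)) ⁻¹' A)
      ≤ ∫⁻ y, (Metric.closedBall (0 : EuclideanSpace ℝ (Fin m)) 1).indicator
          (fun _ => ENNReal.ofReal c) y := by
        refine lintegral_mono fun y => ?_
        by_cases hy : ‖y‖ ≤ 1
        · rw [Set.indicator_of_mem (by simpa using hy)]
          have hy' : 0 ≤ 1 - ‖y‖ ^ 2 := by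
            have := (sq_le_one_iff₀ (norm_nonneg y)).2 hy
            linarith
          calc volume ((fun x => (x, y)) ⁻¹' A)
              ≤ volume (Set.Icc (√(1 - ‖y‖ ^ 2) - c) (√(1 - ‖y‖ ^ 2))) := by
                refine measure_mono fun t ht => ?_
                simp only [hA, Set.mem_preimage, Set.mem_ofPred_eq] at ht
                obtain ⟨hl, hr⟩ := abs_le.1
                  (Real.abs_le_sqrt (x := t) (y := 1 - ‖y‖ ^ 2) (by linarith [ht.1]))
                refine ⟨?_, hr⟩
                by_contra! hlt
                have : (t + c) ^ 2 ≤ √(1 - ‖y‖ ^ 2) ^ 2 := sq_le_sq' (by linarith) (by linarith)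
                rw [Real.sq_sqrt hy'] at this
                linarith [ht.2]
            _ = ENNReal.ofReal c := by rw [Real.volume_Icc]; congr 1; ring
        · have : (fun x : ℝ => (x, y)) ⁻¹' A = ∅ := by
            refine Set.eq_empty_of_forall_notMem fun t ht => hy ?_
            rw [← sq_le_one_iff₀ (norm_nonneg y)]
            nlinarith [ht.1, sq_nonneg t]
          simp [this]
    _ = _ := by
        rw [lintegral_indicator_const Metric.isClosed_closedBall.measurableSet]

lemma volume_closedBall_diff_le {m : ℕ} (h : EuclideanSpace ℝ (Fin (m + 1))) :
    volume (Metric.closedBall (0 : EuclideanSpace ℝ (Fin (m + 1))) 1 \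
      (fun z => z + h) ⁻¹' Metric.closedBall 0 1) ≤
      ENNReal.ofReal ‖h‖ * volume (Metric.closedBall (0 : EuclideanSpace ℝ (Fin m)) 1) := by
  obtain ⟨R, hR⟩ : ∃ R : EuclideanSpace ℝ (Fin (m + 1)) ≃ₗᵢ[ℝ] EuclideanSpace ℝ (Fin (m + 1)),
      R h = EuclideanSpace.single 0 ‖h‖ :=
    ⟨_, Submodule.reflection_sub (by simp)⟩
  have hpre : Metric.closedBall (0 : EuclideanSpace ℝ (Fin (m + 1))) 1 \
      (fun z => z + h) ⁻¹' Metric.closedBall 0 1 =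
      R ⁻¹' (Metric.closedBall (0 : EuclideanSpace ℝ (Fin (m + 1))) 1 \
      (fun z => z + EuclideanSpace.single 0 ‖h‖) ⁻¹' Metric.closedBall 0 1) := by
    ext z
    simp [← hR]
  rw [hpre, R.measurePreserving.measure_preimage]
  · exact volume_closedBall_diff_single_le (norm_nonneg h)
  · exact (Metric.isClosed_closedBall.measurableSet.diff
      (measurable_add_const _ Metric.isClosed_closedBall.measurableSet)).nullMeasurableSet

lemma volume_real_closedBall_diff_le {m : ℕ} (h : EuclideanSpace ℝ (Fin (m + 1))) :
    volume.real (Metric.closedBall (0 : EuclideanSpace ℝ (Fin (m + 1))) 1 \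
      (fun z => z + h) ⁻¹' Metric.closedBall 0 1) ≤
      ‖h‖ * volume.real (Metric.closedBall (0 : EuclideanSpace ℝ (Fin m)) 1) := by
  have := ENNReal.toReal_mono (ENNReal.mul_ne_top ENNReal.ofReal_ne_top
    measure_closedBall_lt_top.ne) (volume_closedBall_diff_le h)
  rwa [ENNReal.toReal_mul, ENNReal.toReal_ofReal (norm_nonneg h)] at this

lemma volume_real_preimage_closedBall_diff_le {m : ℕ} (h : EuclideanSpace ℝ (Fin (m + 1))) :
    volume.real ((fun z => z + h) ⁻¹' Metric.closedBall 0 1 \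
      Metric.closedBall (0 : EuclideanSpace ℝ (Fin (m + 1))) 1) ≤
      ‖h‖ * volume.real (Metric.closedBall (0 : EuclideanSpace ℝ (Fin m)) 1) := by
  have hpre : (fun z => z + h) ⁻¹' Metric.closedBall 0 1 \
      Metric.closedBall (0 : EuclideanSpace ℝ (Fin (m + 1))) 1 =
      (fun z => z + h) ⁻¹' (Metric.closedBall (0 : EuclideanSpace ℝ (Fin (m + 1))) 1 \
        (fun z => z + -h) ⁻¹' Metric.closedBall 0 1) := by
    ext z
    simp
  rw [hpre, Measure.real, measure_preimage_add_right, ← Measure.real, ← norm_neg h]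
  exact volume_real_closedBall_diff_le (-h)

/-- Integrals of a bounded function over two translates of the unit ball are close. -/
lemma norm_setIntegral_closedBall_add_sub_le {n : ℕ} (hn : 1 ≤ n) {F : Type*}
    [NormedAddCommGroup F] [NormedSpace ℝ F] {G : EuclideanSpace ℝ (Fin n) → F}
    (hGm : StronglyMeasurable G) {M : ℝ} (hG : ∀ x, ‖G x‖ ≤ M)
    (h : EuclideanSpace ℝ (Fin n)) :
    ‖(∫ e in Metric.closedBall 0 1, G (e + h)) - ∫ e in Metric.closedBall 0 1, G e‖ ≤
      M * (√n * volume.real (Metric.closedBall (0 : EuclideanSpace ℝ (Fin n)) 1)) * ‖h‖ := by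
  obtain ⟨m, rfl⟩ : ∃ m, n = m + 1 := ⟨n - 1, by omega⟩
  have hM : 0 ≤ M := (norm_nonneg _).trans (hG 0)
  set S := Metric.closedBall (0 : EuclideanSpace ℝ (Fin (m + 1))) 1 with hS
  set T := (fun z => z + -h) ⁻¹' S with hT
  have hSm : MeasurableSet S := Metric.isClosed_closedBall.measurableSet
  have hTm : MeasurableSet T := measurable_add_const _ hSm
  have hSfin : volume S < ⊤ := measure_closedBall_lt_top
  have hTfin : volume T < ⊤ := by rwa [hT, measure_preimage_add_right]
  have hshift : ∫ e in S, G (e + h) = ∫ e in T, G e := by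
    rw [← (measurePreserving_add_right volume h).setIntegral_preimage_emb
      (measurableEmbedding_addRight h) G T]
    congr 2
    ext z
    simp [hT]
  have hint (s : Set (EuclideanSpace ℝ (Fin (m + 1)))) (hs : volume s < ⊤) :
      IntegrableOn G s :=
    Measure.integrableOn_of_bounded hs.ne hGm.aestronglyMeasurable (.of_forall hG)
  rw [hshift, ← integral_inter_add_sdiff hSm (hint T hTfin),
    ← integral_inter_add_sdiff hTm (hint S hSfin), Set.inter_comm, add_sub_add_left_eq_sub]
  have h₁ : ‖∫ e in T \ S, G e‖ ≤ M * volume.real (T \ S) :=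
    norm_setIntegral_le_of_norm_le_const ((measure_mono Set.sdiff_subset).trans_lt hTfin)
      fun x _ => hG x
  have h₂ : ‖∫ e in S \ T, G e‖ ≤ M * volume.real (S \ T) :=
    norm_setIntegral_le_of_norm_le_const ((measure_mono Set.sdiff_subset).trans_lt hSfin)
      fun x _ => hG x
  have h₃ := volume_real_preimage_closedBall_diff_le (-h)
  have h₄ := volume_real_closedBall_diff_le (-h)
  rw [norm_neg] at h₃ h₄
  calc _ ≤ M * volume.real (T \ S) + M * volume.real (S \ T) :=
        (norm_sub_le _ _).trans (add_le_add h₁ h₂)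
    _ ≤ M * (‖h‖ * volume.real (Metric.closedBall (0 : EuclideanSpace ℝ (Fin m)) 1)) +
        M * (‖h‖ * volume.real (Metric.closedBall (0 : EuclideanSpace ℝ (Fin m)) 1)) := by
        gcongr
    _ = M * (2 * volume.real (Metric.closedBall (0 : EuclideanSpace ℝ (Fin m)) 1)) * ‖h‖ := by
        ring
    _ ≤ _ := by
        gcongr ?_ * ?_ * ?_
        exact two_mul_volume_real_closedBall_le m

end EuclideanSpace

/-- Integrating a Lipschitz function over dilated translates of a compact set gives a differentiable
function of the translation, and differentiation commutes with the integral. -/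
lemma LipschitzWith.hasFDerivAt_setIntegral_add_smul {E : Type*} [NormedAddCommGroup E]
    [NormedSpace ℝ E] [FiniteDimensional ℝ E] [MeasurableSpace E] [BorelSpace E]
    {μ : Measure E} [μ.IsAddHaarMeasure] {K : NNReal} {g : E → ℝ} (hg : LipschitzWith K g)
    {s : Set E} (hs : IsCompact s) {γ : ℝ} (hγ : γ ≠ 0) (x : E) :
    HasFDerivAt (fun x => ∫ e in s, g (x + γ • e) ∂μ) (∫ e in s, fderiv ℝ g (x + γ • e) ∂μ) x := by
  have hfin : IsFiniteMeasure (μ.restrict s) := ⟨by simpa using hs.measure_lt_top⟩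
  have hcont (y : E) : Continuous fun e => g (y + γ • e) :=
    hg.continuous.comp (by fun_prop)
  refine (hasFDerivAt_integral_of_dominated_loc_of_lip (bound := fun _ => (K : ℝ))
    Filter.univ_mem (.of_forall fun y => (hcont y).aestronglyMeasurable)
    ((hcont x).continuousOn.integrableOn_compact hs) ?_ (.of_forall fun e => ?_)
    (integrable_const _) ?_).2
  · exact ((measurable_fderiv ℝ g).comp (by fun_prop)).aestronglyMeasurable
  · rw [Real.nnabs_coe, lipschitzOnWith_univ]
    simpa [Function.comp_def] using hg.comp (isometry_add_right (γ • e)).lipschitz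
  · refine ae_restrict_of_ae ?_
    have hmap : Measure.QuasiMeasurePreserving (fun e : E => x + γ • e) μ μ :=
      (measurePreserving_add_left μ x).quasiMeasurePreserving.comp
        ⟨by fun_prop, by
          rw [Measure.map_addHaar_smul μ hγ]
          exact Measure.smul_absolutelyContinuous⟩
    filter_upwards [hmap.ae hg.ae_differentiableAt] with e he
    exact (hasFDerivAt_comp_add_right (γ • e)).2 he.hasFDerivAt

/-- The ℓ₂-ball smoothing of a convex M-Lipschitz function is differentiable with
an (M√n/γ)-Lipschitz gradient (Duchi–Bartlett–Wainwright). -/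
theorem ball_smoothing_gradient_lipschitz (n : ℕ) (hn : 1 ≤ n) (M γ : ℝ)
    (hM : 0 < M) (hγ : 0 < γ) (g : EuclideanSpace ℝ (Fin n) → ℝ)
    (hgconv : ConvexOn ℝ Set.univ g)
    (hg : ∀ x y, |g x - g y| ≤ M * ‖x - y‖)
    (P : Measure (EuclideanSpace ℝ (Fin n)))
    (hP : P = (volume (Metric.closedBall (0 : EuclideanSpace ℝ (Fin n)) 1))⁻¹ •
      volume.restrict (Metric.closedBall (0 : EuclideanSpace ℝ (Fin n)) 1))
    (f : EuclideanSpace ℝ (Fin n) → ℝ)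
    (hf : ∀ x, f x = ∫ e, g (x + γ • e) ∂P) :
    (∀ x, DifferentiableAt ℝ f x) ∧
    (∀ x y, ‖gradient f x - gradient f y‖ ≤ M * Real.sqrt n / γ * ‖x - y‖) := by
  set B := Metric.closedBall (0 : EuclideanSpace ℝ (Fin n)) 1 with hB
  have hlip : LipschitzWith M.toNNReal g :=
    LipschitzWith.of_dist_le_mul fun x y => by
      simpa [dist_eq_norm, hM.le] using hg x y
  have hV : 0 < volume.real B :=
    ENNReal.toReal_pos (Metric.measure_closedBall_pos volume 0 one_pos).ne'
      measure_closedBall_lt_top.ne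
  have hfeq : f = fun x => (volume.real B)⁻¹ • ∫ e in B, g (x + γ • e) := by
    ext x
    rw [hf, hP, integral_smul_measure, ENNReal.toReal_inv, Measure.real]
  have hderiv (x : EuclideanSpace ℝ (Fin n)) :
      HasFDerivAt f ((volume.real B)⁻¹ • ∫ e in B, fderiv ℝ g (x + γ • e)) x := by
    rw [hfeq]
    exact (hlip.hasFDerivAt_setIntegral_add_smul (μ := volume) (isCompact_closedBall 0 1)
      hγ.ne' x).const_smul (volume.real B)⁻¹
  refine ⟨fun x => (hderiv x).differentiableAt, fun x y => ?_⟩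
  have hbound := EuclideanSpace.norm_setIntegral_closedBall_add_sub_le hn
    (G := fun e => fderiv ℝ g (y + γ • e))
    ((measurable_fderiv ℝ g).comp (by fun_prop)).stronglyMeasurable
    (fun e => (norm_fderiv_le_of_lipschitz ℝ hlip).trans_eq (Real.coe_toNNReal M hM.le))
    (γ⁻¹ • (x - y))
  have hshift (e : EuclideanSpace ℝ (Fin n)) :
      y + γ • (e + γ⁻¹ • (x - y)) = x + γ • e := by
    rw [smul_add, smul_inv_smul₀ hγ.ne']
    abel
  simp only [hshift] at hbound
  rw [gradient, gradient, ← map_sub, LinearIsometryEquiv.norm_map, (hderiv x).fderiv,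
    (hderiv y).fderiv, ← smul_sub, norm_smul, norm_inv, Real.norm_of_nonneg hV.le,
    inv_mul_le_iff₀ hV]
  refine hbound.trans_eq ?_
  rw [norm_smul, norm_inv, Real.norm_of_nonneg hγ.le]
  ring
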